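/- arXiv:1604.01670 — 2 statements merged into one kernel-verified Lean document; each statement's English description precedes it below -/
import Mathlib

section
/- Let 𝕜 be a field, let C₁, C₂, C₃ and A be 𝕜-linear abelian categories, and let F : C₂ᵒᵖ × C₁ᵒᵖ × C₁ × C₂ × C₃ ⥤ A be a 𝕜-linear left exact functor. Assume: (i) for all objects u, v of C₂ and w of C₃ the coend G(u, v, w) := ∫^{x ∈ C₁} F(u, x, x, v, w) exists, with dinatural family j_x(u, v, w) : F(u, x, x, v, w) → G(u, v, w), so that G defines a functor C₂ᵒᵖ × C₂ ⥤ Fun(C₃, A); and (ii) G admits a left exact coend H, a finite-limit-preserving functor C₃ ⥤ A with a family h_u(w) : G(u, u, w) → H(w), dinatural in u ∈ C₂ and natural in w, universal among families with these properties valued in finite-limit-preserving functors C₃ ⥤ A. Then the composite family i_{x,u}(w) := h_u(w) ∘ j_x(u, u, w) : F(u, x, x, u, w) → H(w) is dinatural in the pair (x, u) ∈ C₁ × C₂ and exhibits H as a left exact coend of F regarded as a functor (C₁ × C₂)ᵒᵖ × (C₁ × C₂) ⥤ Fun(C₃, A): every family k_{u,x}(w) : F(u, x, x, u, w) → K(w),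 dinatural in (x, u) and natural in w, with K : C₃ ⥤ A preserving finite limits, factors as k = ψ ∘ i for a unique natural transformation ψ : H ⟶ K. -/
/-!
STATEMENT 8 (Lyubashenko Thm. B.2 / Fuchs–Schweigert Prop. 8): Let `C₁, C₂, C₃, A` be
`𝕜`-linear abelian categories and `F : C₂ᵒᵖ × C₁ᵒᵖ × C₁ × C₂ × C₃ ⥤ A` a `𝕜`-linear
left exact functor.  Given (i) coends with parameters
`G(u,v,w) = ∫^{x∈C₁} F(u,x,x,v,w)` with dinatural families `j`, and (ii) a left exact
coend `H` of `G` over `C₂` with family `h`, the composite family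
`i_{x,u}(w) = h_u(w) ∘ j_x(u,u,w)` is dinatural in the pair `(x,u)`, natural in `w`,
and exhibits `H` as a left exact coend of `F` over `C₁ × C₂`.
(`𝕜`-linearity and left exactness of the multivariable functor `F` are expressed
variable-by-variable; conditions involving the functorial action of `G` on parameters
are expressed after precomposition with the universal family `j`, which is an
equivalent formulation by the uniqueness part of the universal property of `G`.)
-/

open CategoryTheory Opposite Limits

set_option maxHeartbeats 1600000

universe v u

/-- A family that is dinatural in each of two variables separately is dinatural in the pair. -/
theorem dinatural_pair_of_separately {C₁ C₂ C₃ A : Type u} [Category.{v} C₁] [Category.{v} C₂]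
    [Category.{v} C₃] [Category.{v} A] (F : C₂ᵒᵖ × C₁ᵒᵖ × C₁ × C₂ × C₃ ⥤ A) {w : C₃} {a : A}
    (k : ∀ (u : C₂) (x : C₁), F.obj (op u, op x, x, u, w) ⟶ a)
    (hx : ∀ (u : C₂) {x x' : C₁} (f : x ⟶ x'),
      F.map ((𝟙 (op u), f.op, 𝟙 x, 𝟙 u, 𝟙 w) :
          (op u, op x', x, u, w) ⟶ (op u, op x, x, u, w)) ≫ k u x =
        F.map ((𝟙 (op u), 𝟙 (op x'), f, 𝟙 u, 𝟙 w) :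
          (op u, op x', x, u, w) ⟶ (op u, op x', x', u, w)) ≫ k u x')
    (hu : ∀ {u u' : C₂} (g : u ⟶ u') (x : C₁),
      F.map ((g.op, 𝟙 (op x), 𝟙 x, 𝟙 u, 𝟙 w) :
          (op u', op x, x, u, w) ⟶ (op u, op x, x, u, w)) ≫ k u x =
        F.map ((𝟙 (op u'), 𝟙 (op x), 𝟙 x, g, 𝟙 w) :
          (op u', op x, x, u, w) ⟶ (op u', op x, x, u', w)) ≫ k u' x)
    {x x' : C₁} (f : x ⟶ x') {u u' : C₂} (g : u ⟶ u') :
    F.map ((g.op, f.op, 𝟙 x, 𝟙 u, 𝟙 w) :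
        (op u', op x', x, u, w) ⟶ (op u, op x, x, u, w)) ≫ k u x =
      F.map ((𝟙 (op u'), 𝟙 (op x'), f, g, 𝟙 w) :
        (op u', op x', x, u, w) ⟶ (op u', op x', x', u', w)) ≫ k u' x' := by
  calc
    _ = F.map ((𝟙 (op u'), f.op, 𝟙 x, 𝟙 u, 𝟙 w) :
          (op u', op x', x, u, w) ⟶ (op u', op x, x, u, w)) ≫
        F.map ((g.op, 𝟙 (op x), 𝟙 x, 𝟙 u, 𝟙 w) :
          (op u', op x, x, u, w) ⟶ (op u, op x, x, u, w)) ≫ k u x := by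
      rw [← F.map_comp_assoc]
      simp only [prod_comp, Category.id_comp, Category.comp_id]
    _ = F.map ((𝟙 (op u'), f.op, 𝟙 x, 𝟙 u, 𝟙 w) :
          (op u', op x', x, u, w) ⟶ (op u', op x, x, u, w)) ≫
        F.map ((𝟙 (op u'), 𝟙 (op x), 𝟙 x, g, 𝟙 w) :
          (op u', op x, x, u, w) ⟶ (op u', op x, x, u', w)) ≫ k u' x := by
      rw [hu]
    _ = F.map ((𝟙 (op u'), 𝟙 (op x'), 𝟙 x, g, 𝟙 w) :
          (op u', op x', x, u, w) ⟶ (op u', op x', x, u', w)) ≫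
        F.map ((𝟙 (op u'), f.op, 𝟙 x, 𝟙 u', 𝟙 w) :
          (op u', op x', x, u', w) ⟶ (op u', op x, x, u', w)) ≫ k u' x := by
      rw [← F.map_comp_assoc, ← F.map_comp_assoc]
      simp only [prod_comp, Category.id_comp, Category.comp_id]
    _ = F.map ((𝟙 (op u'), 𝟙 (op x'), 𝟙 x, g, 𝟙 w) :
          (op u', op x', x, u, w) ⟶ (op u', op x', x, u', w)) ≫
        F.map ((𝟙 (op u'), 𝟙 (op x'), f, 𝟙 u', 𝟙 w) :
          (op u', op x', x, u', w) ⟶ (op u', op x', x', u', w)) ≫ k u' x' := by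
      rw [hx]
    _ = _ := by
      rw [← F.map_comp_assoc]
      simp only [prod_comp, Category.id_comp, Category.comp_id]

theorem left_exact_coend_iterated {𝕜 : Type v} [Field 𝕜]
    {C₁ : Type u} [Category.{v} C₁] [Abelian C₁] [CategoryTheory.Linear 𝕜 C₁]
    {C₂ : Type u} [Category.{v} C₂] [Abelian C₂] [CategoryTheory.Linear 𝕜 C₂]
    {C₃ : Type u} [Category.{v} C₃] [Abelian C₃] [CategoryTheory.Linear 𝕜 C₃]
    {A : Type u} [Category.{v} A] [Abelian A] [CategoryTheory.Linear 𝕜 A]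
    (F : C₂ᵒᵖ × C₁ᵒᵖ × C₁ × C₂ × C₃ ⥤ A)
    -- `F` is additive and `𝕜`-linear in each variable
    (hFadd : ∀ {u u' : C₂} (a a' : u' ⟶ u) {y y' : C₁} (b b' : y' ⟶ y)
        {x x' : C₁} (c c' : x ⟶ x') {v v' : C₂} (d d' : v ⟶ v') {w w' : C₃}
        (e e' : w ⟶ w') (r : 𝕜) (u₀ : C₂) (y₀ : C₁) (x₀ : C₁) (v₀ : C₂) (w₀ : C₃),
      (F.map (((a + a').op, 𝟙 (op y₀), 𝟙 x₀, 𝟙 v₀, 𝟙 w₀) :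
          (op u, op y₀, x₀, v₀, w₀) ⟶ (op u', op y₀, x₀, v₀, w₀)) =
        F.map ((a.op, 𝟙 (op y₀), 𝟙 x₀, 𝟙 v₀, 𝟙 w₀)) +
          F.map ((a'.op, 𝟙 (op y₀), 𝟙 x₀, 𝟙 v₀, 𝟙 w₀))) ∧
      (F.map (((r • a).op, 𝟙 (op y₀), 𝟙 x₀, 𝟙 v₀, 𝟙 w₀) :
          (op u, op y₀, x₀, v₀, w₀) ⟶ (op u', op y₀, x₀, v₀, w₀)) =
        r • F.map ((a.op, 𝟙 (op y₀), 𝟙 x₀, 𝟙 v₀, 𝟙 w₀))) ∧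
      (F.map ((𝟙 (op u₀), (b + b').op, 𝟙 x₀, 𝟙 v₀, 𝟙 w₀) :
          (op u₀, op y, x₀, v₀, w₀) ⟶ (op u₀, op y', x₀, v₀, w₀)) =
        F.map ((𝟙 (op u₀), b.op, 𝟙 x₀, 𝟙 v₀, 𝟙 w₀)) +
          F.map ((𝟙 (op u₀), b'.op, 𝟙 x₀, 𝟙 v₀, 𝟙 w₀))) ∧
      (F.map ((𝟙 (op u₀), (r • b).op, 𝟙 x₀, 𝟙 v₀, 𝟙 w₀) :
          (op u₀, op y, x₀, v₀, w₀) ⟶ (op u₀, op y', x₀, v₀, w₀)) =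
        r • F.map ((𝟙 (op u₀), b.op, 𝟙 x₀, 𝟙 v₀, 𝟙 w₀))) ∧
      (F.map ((𝟙 (op u₀), 𝟙 (op y₀), c + c', 𝟙 v₀, 𝟙 w₀) :
          (op u₀, op y₀, x, v₀, w₀) ⟶ (op u₀, op y₀, x', v₀, w₀)) =
        F.map ((𝟙 (op u₀), 𝟙 (op y₀), c, 𝟙 v₀, 𝟙 w₀)) +
          F.map ((𝟙 (op u₀), 𝟙 (op y₀), c', 𝟙 v₀, 𝟙 w₀))) ∧
      (F.map ((𝟙 (op u₀), 𝟙 (op y₀), r • c, 𝟙 v₀, 𝟙 w₀) :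
          (op u₀, op y₀, x, v₀, w₀) ⟶ (op u₀, op y₀, x', v₀, w₀)) =
        r • F.map ((𝟙 (op u₀), 𝟙 (op y₀), c, 𝟙 v₀, 𝟙 w₀))) ∧
      (F.map ((𝟙 (op u₀), 𝟙 (op y₀), 𝟙 x₀, d + d', 𝟙 w₀) :
          (op u₀, op y₀, x₀, v, w₀) ⟶ (op u₀, op y₀, x₀, v', w₀)) =
        F.map ((𝟙 (op u₀), 𝟙 (op y₀), 𝟙 x₀, d, 𝟙 w₀)) +
          F.map ((𝟙 (op u₀), 𝟙 (op y₀), 𝟙 x₀, d', 𝟙 w₀))) ∧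
      (F.map ((𝟙 (op u₀), 𝟙 (op y₀), 𝟙 x₀, r • d, 𝟙 w₀) :
          (op u₀, op y₀, x₀, v, w₀) ⟶ (op u₀, op y₀, x₀, v', w₀)) =
        r • F.map ((𝟙 (op u₀), 𝟙 (op y₀), 𝟙 x₀, d, 𝟙 w₀))) ∧
      (F.map ((𝟙 (op u₀), 𝟙 (op y₀), 𝟙 x₀, 𝟙 v₀, e + e') :
          (op u₀, op y₀, x₀, v₀, w) ⟶ (op u₀, op y₀, x₀, v₀, w')) =
        F.map ((𝟙 (op u₀), 𝟙 (op y₀), 𝟙 x₀, 𝟙 v₀, e)) +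
          F.map ((𝟙 (op u₀), 𝟙 (op y₀), 𝟙 x₀, 𝟙 v₀, e'))) ∧
      (F.map ((𝟙 (op u₀), 𝟙 (op y₀), 𝟙 x₀, 𝟙 v₀, r • e) :
          (op u₀, op y₀, x₀, v₀, w) ⟶ (op u₀, op y₀, x₀, v₀, w')) =
        r • F.map ((𝟙 (op u₀), 𝟙 (op y₀), 𝟙 x₀, 𝟙 v₀, e))))
    -- `F` is left exact in each variable
    (hFlex₁ : ∀ (y : C₁ᵒᵖ) (x : C₁) (v : C₂) (w : C₃),
      PreservesFiniteLimits (Prod.sectL C₂ᵒᵖ (y, x, v, w) ⋙ F))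
    (hFlex₂ : ∀ (u : C₂ᵒᵖ) (x : C₁) (v : C₂) (w : C₃),
      PreservesFiniteLimits (Prod.sectL C₁ᵒᵖ (x, v, w) ⋙ Prod.sectR u _ ⋙ F))
    (hFlex₃ : ∀ (u : C₂ᵒᵖ) (y : C₁ᵒᵖ) (v : C₂) (w : C₃),
      PreservesFiniteLimits
        (Prod.sectL C₁ (v, w) ⋙ Prod.sectR y _ ⋙ Prod.sectR u _ ⋙ F))
    (hFlex₄ : ∀ (u : C₂ᵒᵖ) (y : C₁ᵒᵖ) (x : C₁) (w : C₃),
      PreservesFiniteLimits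
        (Prod.sectL C₂ w ⋙ Prod.sectR x _ ⋙ Prod.sectR y _ ⋙ Prod.sectR u _ ⋙ F))
    (hFlex₅ : ∀ (u : C₂ᵒᵖ) (y : C₁ᵒᵖ) (x : C₁) (v : C₂),
      PreservesFiniteLimits
        (Prod.sectR v C₃ ⋙ Prod.sectR x _ ⋙ Prod.sectR y _ ⋙ Prod.sectR u _ ⋙ F))
    -- (i) the inner coends with parameters `G(u,v,w) = ∫^{x∈C₁} F(u,x,x,v,w)`
    (G : C₂ → C₂ → C₃ → A)
    (j : ∀ (u v : C₂) (w : C₃) (x : C₁), F.obj (op u, op x, x, v, w) ⟶ G u v w)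
    (hjdinat : ∀ (u v : C₂) (w : C₃) {x x' : C₁} (f : x ⟶ x'),
      F.map ((𝟙 (op u), f.op, 𝟙 x, 𝟙 v, 𝟙 w) :
          (op u, op x', x, v, w) ⟶ (op u, op x, x, v, w)) ≫ j u v w x =
        F.map ((𝟙 (op u), 𝟙 (op x'), f, 𝟙 v, 𝟙 w) :
          (op u, op x', x, v, w) ⟶ (op u, op x', x', v, w)) ≫ j u v w x')
    (hjuniv : ∀ (u v : C₂) (w : C₃) (a : A)
        (α : ∀ x : C₁, F.obj (op u, op x, x, v, w) ⟶ a),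
      (∀ {x x' : C₁} (f : x ⟶ x'),
        F.map ((𝟙 (op u), f.op, 𝟙 x, 𝟙 v, 𝟙 w) :
            (op u, op x', x, v, w) ⟶ (op u, op x, x, v, w)) ≫ α x =
          F.map ((𝟙 (op u), 𝟙 (op x'), f, 𝟙 v, 𝟙 w) :
            (op u, op x', x, v, w) ⟶ (op u, op x', x', v, w)) ≫ α x') →
      ∃! κ : G u v w ⟶ a, ∀ x : C₁, j u v w x ≫ κ = α x)
    -- (ii) a left exact coend `H` of `G` over `C₂`, with family `h`
    (H : C₃ ⥤ A) (hHlex : PreservesFiniteLimits H)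
    (h : ∀ (u : C₂) (w : C₃), G u u w ⟶ H.obj w)
    -- `h` is natural in `w` (expressed after precomposing with `j`)
    (hhnat : ∀ (u : C₂) {w w' : C₃} (e : w ⟶ w') (x : C₁),
      j u u w x ≫ h u w ≫ H.map e =
        F.map ((𝟙 (op u), 𝟙 (op x), 𝟙 x, 𝟙 u, e) :
          (op u, op x, x, u, w) ⟶ (op u, op x, x, u, w')) ≫ j u u w' x ≫ h u w')
    -- `h` is dinatural in `u` (expressed after precomposing with `j`)
    (hhdinat : ∀ {u u' : C₂} (g : u ⟶ u') (w : C₃) (x : C₁),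
      F.map ((g.op, 𝟙 (op x), 𝟙 x, 𝟙 u, 𝟙 w) :
          (op u', op x, x, u, w) ⟶ (op u, op x, x, u, w)) ≫ j u u w x ≫ h u w =
        F.map ((𝟙 (op u'), 𝟙 (op x), 𝟙 x, g, 𝟙 w) :
          (op u', op x, x, u, w) ⟶ (op u', op x, x, u', w)) ≫ j u' u' w x ≫ h u' w)
    -- universality of `(H, h)` among such families valued in left exact functors
    (hhuniv : ∀ (K : C₃ ⥤ A), PreservesFiniteLimits K →
      ∀ (β : ∀ (u : C₂) (w : C₃), G u u w ⟶ K.obj w),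
      (∀ (u : C₂) {w w' : C₃} (e : w ⟶ w') (x : C₁),
        j u u w x ≫ β u w ≫ K.map e =
          F.map ((𝟙 (op u), 𝟙 (op x), 𝟙 x, 𝟙 u, e) :
            (op u, op x, x, u, w) ⟶ (op u, op x, x, u, w')) ≫ j u u w' x ≫ β u w') →
      (∀ {u u' : C₂} (g : u ⟶ u') (w : C₃) (x : C₁),
        F.map ((g.op, 𝟙 (op x), 𝟙 x, 𝟙 u, 𝟙 w) :
            (op u', op x, x, u, w) ⟶ (op u, op x, x, u, w)) ≫ j u u w x ≫ β u w =
          F.map ((𝟙 (op u'), 𝟙 (op x), 𝟙 x, g, 𝟙 w) :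
            (op u', op x, x, u, w) ⟶ (op u', op x, x, u', w)) ≫ j u' u' w x ≫ β u' w) →
      ∃! ψ : ∀ w : C₃, H.obj w ⟶ K.obj w,
        (∀ {w w' : C₃} (e : w ⟶ w'), H.map e ≫ ψ w' = ψ w ≫ K.map e) ∧
        (∀ (u : C₂) (w : C₃), h u w ≫ ψ w = β u w)) :
    -- CONCLUSION: the composite family `i_{x,u}(w) = j_x(u,u,w) ≫ h_u(w)`
    -- is dinatural in the pair `(x, u) ∈ C₁ × C₂` ...
    (∀ {x x' : C₁} (f : x ⟶ x') {u u' : C₂} (g : u ⟶ u') (w : C₃),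
      F.map ((g.op, f.op, 𝟙 x, 𝟙 u, 𝟙 w) :
          (op u', op x', x, u, w) ⟶ (op u, op x, x, u, w)) ≫ j u u w x ≫ h u w =
        F.map ((𝟙 (op u'), 𝟙 (op x'), f, g, 𝟙 w) :
          (op u', op x', x, u, w) ⟶ (op u', op x', x', u', w)) ≫ j u' u' w x' ≫ h u' w) ∧
    -- ... natural in `w` ...
    (∀ {w w' : C₃} (e : w ⟶ w') (x : C₁) (u : C₂),
      (j u u w x ≫ h u w) ≫ H.map e =
        F.map ((𝟙 (op u), 𝟙 (op x), 𝟙 x, 𝟙 u, e) :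
          (op u, op x, x, u, w) ⟶ (op u, op x, x, u, w')) ≫ j u u w' x ≫ h u w') ∧
    -- ... and exhibits `H` as a left exact coend of `F` over `C₁ × C₂`: every family
    -- `k`, dinatural in `(x, u)` and natural in `w`, valued in a finite-limit
    -- preserving functor `K`, factors through `i` via a unique natural transformation
    (∀ (K : C₃ ⥤ A), PreservesFiniteLimits K →
      ∀ (k : ∀ (u : C₂) (x : C₁) (w : C₃), F.obj (op u, op x, x, u, w) ⟶ K.obj w),
      (∀ {x x' : C₁} (f : x ⟶ x') {u u' : C₂} (g : u ⟶ u') (w : C₃),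
        F.map ((g.op, f.op, 𝟙 x, 𝟙 u, 𝟙 w) :
            (op u', op x', x, u, w) ⟶ (op u, op x, x, u, w)) ≫ k u x w =
          F.map ((𝟙 (op u'), 𝟙 (op x'), f, g, 𝟙 w) :
            (op u', op x', x, u, w) ⟶ (op u', op x', x', u', w)) ≫ k u' x' w) →
      (∀ {w w' : C₃} (e : w ⟶ w') (x : C₁) (u : C₂),
        k u x w ≫ K.map e =
          F.map ((𝟙 (op u), 𝟙 (op x), 𝟙 x, 𝟙 u, e) :
            (op u, op x, x, u, w) ⟶ (op u, op x, x, u, w')) ≫ k u x w') →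
      ∃! ψ : ∀ w : C₃, H.obj w ⟶ K.obj w,
        (∀ {w w' : C₃} (e : w ⟶ w'), H.map e ≫ ψ w' = ψ w ≫ K.map e) ∧
        (∀ (u : C₂) (x : C₁) (w : C₃), (j u u w x ≫ h u w) ≫ ψ w = k u x w)) := by
  refine ⟨fun f _ _ g w => dinatural_pair_of_separately F (fun u x => j u u w x ≫ h u w)
      (fun u _ _ f => ?_) (fun g x => hhdinat g w x) f g,
    fun e x u => by rw [Category.assoc, hhnat], fun K hK k hkdinat hknat => ?_⟩
  · rw [← Category.assoc, hjdinat, Category.assoc]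
  · have hdesc : ∀ (u : C₂) (w : C₃), ∃! κ : G u u w ⟶ K.obj w,
        ∀ x : C₁, j u u w x ≫ κ = k u x w := fun u w =>
      hjuniv u u w (K.obj w) (fun x => k u x w) fun f => hkdinat f (𝟙 u) w
    choose β hβ hβuniq using hdesc
    obtain ⟨ψ, ⟨hψnat, hψ⟩, hψuniq⟩ := hhuniv K hK β
      (fun u w w' e x => by
        rw [← Category.assoc, hβ, hβ]
        exact hknat e x u)
      (fun g w x => by
        rw [hβ, hβ]
        exact hkdinat (𝟙 x) g w)
    refine ⟨ψ, ⟨hψnat, fun u x w => by rw [Category.assoc, hψ, hβ]⟩, fun ψ' hψ' => ?_⟩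
    exact hψuniq ψ' ⟨hψ'.1, fun u w => hβuniq u w _ fun x => by
      rw [← Category.assoc]
      exact hψ'.2 u x w⟩
end

section
/- Let 𝕜 be a field, let C₁, C₂, C₃ and A be 𝕜-linear abelian categories, and let F : C₂ᵒᵖ × C₁ᵒᵖ × C₁ × C₂ × C₃ ⥤ A be a 𝕜-linear left exact functor. Assume that the iterated left exact coend ∮^{u ∈ C₂} ∫^{x ∈ C₁} F(u, x, x, u, -) exists (i.e. all inner coends over C₁ exist and the resulting functor of (u, u') admits a left exact coend over C₂) and, symmetrically, that the iterated left exact coend ∮^{x ∈ C₁} ∫^{u ∈ C₂} F(u, x, x, u, -) exists. Then there is a unique isomorphism ∮^{u ∈ C₂} ∫^{x ∈ C₁} F(u, x, x, u, -) ≅ ∮^{x ∈ C₁} ∫^{u ∈ C₂} F(u, x, x, u, -) of functors C₃ ⥤ A that is compatible with the composite dinatural families on both sides. -/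
/-!
STATEMENT 9 (Fuchs–Schweigert Cor. 9, Fubini for left exact coends): Let `C₁, C₂, C₃, A`
be `𝕜`-linear abelian categories and `F : C₂ᵒᵖ × C₁ᵒᵖ × C₁ × C₂ × C₃ ⥤ A` a `𝕜`-linear
left exact functor.  If both iterated left exact coends
`∮^{u∈C₂} ∫^{x∈C₁} F(u,x,x,u,-)` (realized by data `(G₁, j₁, H₁, h₁)`) and
`∮^{x∈C₁} ∫^{u∈C₂} F(u,x,x,u,-)` (realized by data `(G₂, j₂, H₂, h₂)`) exist, then
there is a unique isomorphism `H₁ ≅ H₂` of functors `C₃ ⥤ A` compatible with the two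
composite dinatural families.
(`𝕜`-linearity and left exactness of the multivariable functor `F` are expressed
variable-by-variable; conditions involving the functorial action of the inner coends on
their parameters are expressed after precomposition with the universal families, which
is an equivalent formulation by the uniqueness part of their universal properties.)
-/

open CategoryTheory Opposite Limits

set_option maxHeartbeats 1600000

universe v u

/-- Two families which are universal among the families satisfying a predicate `P` are related by
a unique compatible natural transformation, and it is an isomorphism. -/
theorem existsUnique_isIso_of_universal_family {C A : Type*} [Category C] [Category A]
    {U X : Type*} (D : U → X → C → A)
    (P : ∀ K : C ⥤ A, (∀ u x w, D u x w ⟶ K.obj w) → Prop)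
    (H₁ H₂ : C ⥤ A) (ι₁ : ∀ u x w, D u x w ⟶ H₁.obj w) (ι₂ : ∀ u x w, D u x w ⟶ H₂.obj w)
    (hι₁ : P H₁ ι₁) (hι₂ : P H₂ ι₂)
    (univ₁ : ∀ K γ, P K γ → ∃! ψ : ∀ w, H₁.obj w ⟶ K.obj w,
      (∀ {w w' : C} (e : w ⟶ w'), H₁.map e ≫ ψ w' = ψ w ≫ K.map e) ∧
      (∀ u x w, ι₁ u x w ≫ ψ w = γ u x w))
    (univ₂ : ∀ K γ, P K γ → ∃! ψ : ∀ w, H₂.obj w ⟶ K.obj w,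
      (∀ {w w' : C} (e : w ⟶ w'), H₂.map e ≫ ψ w' = ψ w ≫ K.map e) ∧
      (∀ u x w, ι₂ u x w ≫ ψ w = γ u x w)) :
    ∃! φ : ∀ w, H₁.obj w ⟶ H₂.obj w,
      (∀ {w w' : C} (e : w ⟶ w'), H₁.map e ≫ φ w' = φ w ≫ H₂.map e) ∧
      (∀ u x w, ι₁ u x w ≫ φ w = ι₂ u x w) ∧ (∀ w, IsIso (φ w)) := by
  obtain ⟨φ, ⟨hφn, hφ⟩, hφu⟩ := univ₁ H₂ ι₂ hι₂
  obtain ⟨θ, ⟨hθn, hθ⟩, -⟩ := univ₂ H₁ ι₁ hι₁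
  have h₁ : (fun w => φ w ≫ θ w) = fun w => 𝟙 (H₁.obj w) :=
    (univ₁ H₁ ι₁ hι₁).unique
      ⟨fun e => by rw [← Category.assoc, hφn, Category.assoc, hθn, Category.assoc],
        fun u x w => by rw [← Category.assoc, hφ, hθ]⟩
      ⟨fun e => by simp, fun u x w => by simp⟩
  have h₂ : (fun w => θ w ≫ φ w) = fun w => 𝟙 (H₂.obj w) :=
    (univ₂ H₂ ι₂ hι₂).unique
      ⟨fun e => by rw [← Category.assoc, hθn, Category.assoc, hφn, Category.assoc],
        fun u x w => by rw [← Category.assoc, hθ, hφ]⟩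
      ⟨fun e => by simp, fun u x w => by simp⟩
  exact ⟨φ, ⟨hφn, hφ, fun w => ⟨θ w, congrFun h₁ w, congrFun h₂ w⟩⟩,
    fun φ' hφ' => hφu φ' ⟨hφ'.1, hφ'.2.1⟩⟩

theorem fubini_left_exact_coends {𝕜 : Type v} [Field 𝕜]
    {C₁ : Type u} [Category.{v} C₁] [Abelian C₁] [CategoryTheory.Linear 𝕜 C₁]
    {C₂ : Type u} [Category.{v} C₂] [Abelian C₂] [CategoryTheory.Linear 𝕜 C₂]
    {C₃ : Type u} [Category.{v} C₃] [Abelian C₃] [CategoryTheory.Linear 𝕜 C₃]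
    {A : Type u} [Category.{v} A] [Abelian A] [CategoryTheory.Linear 𝕜 A]
    (F : C₂ᵒᵖ × C₁ᵒᵖ × C₁ × C₂ × C₃ ⥤ A)
    -- `F` is additive and `𝕜`-linear in each variable
    (hFadd : ∀ {u u' : C₂} (a a' : u' ⟶ u) {y y' : C₁} (b b' : y' ⟶ y)
        {x x' : C₁} (c c' : x ⟶ x') {v v' : C₂} (d d' : v ⟶ v') {w w' : C₃}
        (e e' : w ⟶ w') (r : 𝕜) (u₀ : C₂) (y₀ : C₁) (x₀ : C₁) (v₀ : C₂) (w₀ : C₃),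
      (F.map (((a + a').op, 𝟙 (op y₀), 𝟙 x₀, 𝟙 v₀, 𝟙 w₀) :
          (op u, op y₀, x₀, v₀, w₀) ⟶ (op u', op y₀, x₀, v₀, w₀)) =
        F.map ((a.op, 𝟙 (op y₀), 𝟙 x₀, 𝟙 v₀, 𝟙 w₀)) +
          F.map ((a'.op, 𝟙 (op y₀), 𝟙 x₀, 𝟙 v₀, 𝟙 w₀))) ∧
      (F.map (((r • a).op, 𝟙 (op y₀), 𝟙 x₀, 𝟙 v₀, 𝟙 w₀) :
          (op u, op y₀, x₀, v₀, w₀) ⟶ (op u', op y₀, x₀, v₀, w₀)) =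
        r • F.map ((a.op, 𝟙 (op y₀), 𝟙 x₀, 𝟙 v₀, 𝟙 w₀))) ∧
      (F.map ((𝟙 (op u₀), (b + b').op, 𝟙 x₀, 𝟙 v₀, 𝟙 w₀) :
          (op u₀, op y, x₀, v₀, w₀) ⟶ (op u₀, op y', x₀, v₀, w₀)) =
        F.map ((𝟙 (op u₀), b.op, 𝟙 x₀, 𝟙 v₀, 𝟙 w₀)) +
          F.map ((𝟙 (op u₀), b'.op, 𝟙 x₀, 𝟙 v₀, 𝟙 w₀))) ∧
      (F.map ((𝟙 (op u₀), (r • b).op, 𝟙 x₀, 𝟙 v₀, 𝟙 w₀) :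
          (op u₀, op y, x₀, v₀, w₀) ⟶ (op u₀, op y', x₀, v₀, w₀)) =
        r • F.map ((𝟙 (op u₀), b.op, 𝟙 x₀, 𝟙 v₀, 𝟙 w₀))) ∧
      (F.map ((𝟙 (op u₀), 𝟙 (op y₀), c + c', 𝟙 v₀, 𝟙 w₀) :
          (op u₀, op y₀, x, v₀, w₀) ⟶ (op u₀, op y₀, x', v₀, w₀)) =
        F.map ((𝟙 (op u₀), 𝟙 (op y₀), c, 𝟙 v₀, 𝟙 w₀)) +
          F.map ((𝟙 (op u₀), 𝟙 (op y₀), c', 𝟙 v₀, 𝟙 w₀))) ∧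
      (F.map ((𝟙 (op u₀), 𝟙 (op y₀), r • c, 𝟙 v₀, 𝟙 w₀) :
          (op u₀, op y₀, x, v₀, w₀) ⟶ (op u₀, op y₀, x', v₀, w₀)) =
        r • F.map ((𝟙 (op u₀), 𝟙 (op y₀), c, 𝟙 v₀, 𝟙 w₀))) ∧
      (F.map ((𝟙 (op u₀), 𝟙 (op y₀), 𝟙 x₀, d + d', 𝟙 w₀) :
          (op u₀, op y₀, x₀, v, w₀) ⟶ (op u₀, op y₀, x₀, v', w₀)) =
        F.map ((𝟙 (op u₀), 𝟙 (op y₀), 𝟙 x₀, d, 𝟙 w₀)) +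
          F.map ((𝟙 (op u₀), 𝟙 (op y₀), 𝟙 x₀, d', 𝟙 w₀))) ∧
      (F.map ((𝟙 (op u₀), 𝟙 (op y₀), 𝟙 x₀, r • d, 𝟙 w₀) :
          (op u₀, op y₀, x₀, v, w₀) ⟶ (op u₀, op y₀, x₀, v', w₀)) =
        r • F.map ((𝟙 (op u₀), 𝟙 (op y₀), 𝟙 x₀, d, 𝟙 w₀))) ∧
      (F.map ((𝟙 (op u₀), 𝟙 (op y₀), 𝟙 x₀, 𝟙 v₀, e + e') :
          (op u₀, op y₀, x₀, v₀, w) ⟶ (op u₀, op y₀, x₀, v₀, w')) =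
        F.map ((𝟙 (op u₀), 𝟙 (op y₀), 𝟙 x₀, 𝟙 v₀, e)) +
          F.map ((𝟙 (op u₀), 𝟙 (op y₀), 𝟙 x₀, 𝟙 v₀, e'))) ∧
      (F.map ((𝟙 (op u₀), 𝟙 (op y₀), 𝟙 x₀, 𝟙 v₀, r • e) :
          (op u₀, op y₀, x₀, v₀, w) ⟶ (op u₀, op y₀, x₀, v₀, w')) =
        r • F.map ((𝟙 (op u₀), 𝟙 (op y₀), 𝟙 x₀, 𝟙 v₀, e))))
    -- `F` is left exact in each variable
    (hFlex₁ : ∀ (y : C₁ᵒᵖ) (x : C₁) (v : C₂) (w : C₃),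
      PreservesFiniteLimits (Prod.sectL C₂ᵒᵖ (y, x, v, w) ⋙ F))
    (hFlex₂ : ∀ (u : C₂ᵒᵖ) (x : C₁) (v : C₂) (w : C₃),
      PreservesFiniteLimits (Prod.sectL C₁ᵒᵖ (x, v, w) ⋙ Prod.sectR u _ ⋙ F))
    (hFlex₃ : ∀ (u : C₂ᵒᵖ) (y : C₁ᵒᵖ) (v : C₂) (w : C₃),
      PreservesFiniteLimits
        (Prod.sectL C₁ (v, w) ⋙ Prod.sectR y _ ⋙ Prod.sectR u _ ⋙ F))
    (hFlex₄ : ∀ (u : C₂ᵒᵖ) (y : C₁ᵒᵖ) (x : C₁) (w : C₃),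
      PreservesFiniteLimits
        (Prod.sectL C₂ w ⋙ Prod.sectR x _ ⋙ Prod.sectR y _ ⋙ Prod.sectR u _ ⋙ F))
    (hFlex₅ : ∀ (u : C₂ᵒᵖ) (y : C₁ᵒᵖ) (x : C₁) (v : C₂),
      PreservesFiniteLimits
        (Prod.sectR v C₃ ⋙ Prod.sectR x _ ⋙ Prod.sectR y _ ⋙ Prod.sectR u _ ⋙ F))
    -- (i) the inner coends with parameters `G₁(u,v,w) = ∫^{x∈C₁} F(u,x,x,v,w)`
    (G₁ : C₂ → C₂ → C₃ → A)
    (j₁ : ∀ (u v : C₂) (w : C₃) (x : C₁), F.obj (op u, op x, x, v, w) ⟶ G₁ u v w)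
    (hj₁dinat : ∀ (u v : C₂) (w : C₃) {x x' : C₁} (f : x ⟶ x'),
      F.map ((𝟙 (op u), f.op, 𝟙 x, 𝟙 v, 𝟙 w) :
          (op u, op x', x, v, w) ⟶ (op u, op x, x, v, w)) ≫ j₁ u v w x =
        F.map ((𝟙 (op u), 𝟙 (op x'), f, 𝟙 v, 𝟙 w) :
          (op u, op x', x, v, w) ⟶ (op u, op x', x', v, w)) ≫ j₁ u v w x')
    (hj₁univ : ∀ (u v : C₂) (w : C₃) (a : A)
        (α : ∀ x : C₁, F.obj (op u, op x, x, v, w) ⟶ a),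
      (∀ {x x' : C₁} (f : x ⟶ x'),
        F.map ((𝟙 (op u), f.op, 𝟙 x, 𝟙 v, 𝟙 w) :
            (op u, op x', x, v, w) ⟶ (op u, op x, x, v, w)) ≫ α x =
          F.map ((𝟙 (op u), 𝟙 (op x'), f, 𝟙 v, 𝟙 w) :
            (op u, op x', x, v, w) ⟶ (op u, op x', x', v, w)) ≫ α x') →
      ∃! κ : G₁ u v w ⟶ a, ∀ x : C₁, j₁ u v w x ≫ κ = α x)
    -- (ii) a left exact coend `H₁` of `G₁` over `C₂`, with family `h₁`
    (H₁ : C₃ ⥤ A) (hH₁lex : PreservesFiniteLimits H₁)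
    (h₁ : ∀ (u : C₂) (w : C₃), G₁ u u w ⟶ H₁.obj w)
    -- `h₁` is natural in `w` (expressed after precomposing with `j₁`)
    (hh₁nat : ∀ (u : C₂) {w w' : C₃} (e : w ⟶ w') (x : C₁),
      j₁ u u w x ≫ h₁ u w ≫ H₁.map e =
        F.map ((𝟙 (op u), 𝟙 (op x), 𝟙 x, 𝟙 u, e) :
          (op u, op x, x, u, w) ⟶ (op u, op x, x, u, w')) ≫ j₁ u u w' x ≫ h₁ u w')
    -- `h₁` is dinatural in `u` (expressed after precomposing with `j₁`)
    (hh₁dinat : ∀ {u u' : C₂} (g : u ⟶ u') (w : C₃) (x : C₁),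
      F.map ((g.op, 𝟙 (op x), 𝟙 x, 𝟙 u, 𝟙 w) :
          (op u', op x, x, u, w) ⟶ (op u, op x, x, u, w)) ≫ j₁ u u w x ≫ h₁ u w =
        F.map ((𝟙 (op u'), 𝟙 (op x), 𝟙 x, g, 𝟙 w) :
          (op u', op x, x, u, w) ⟶ (op u', op x, x, u', w)) ≫ j₁ u' u' w x ≫ h₁ u' w)
    -- universality of `(H₁, h₁)` among such families valued in left exact functors
    (hh₁univ : ∀ (K : C₃ ⥤ A), PreservesFiniteLimits K →
      ∀ (β : ∀ (u : C₂) (w : C₃), G₁ u u w ⟶ K.obj w),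
      (∀ (u : C₂) {w w' : C₃} (e : w ⟶ w') (x : C₁),
        j₁ u u w x ≫ β u w ≫ K.map e =
          F.map ((𝟙 (op u), 𝟙 (op x), 𝟙 x, 𝟙 u, e) :
            (op u, op x, x, u, w) ⟶ (op u, op x, x, u, w')) ≫ j₁ u u w' x ≫ β u w') →
      (∀ {u u' : C₂} (g : u ⟶ u') (w : C₃) (x : C₁),
        F.map ((g.op, 𝟙 (op x), 𝟙 x, 𝟙 u, 𝟙 w) :
            (op u', op x, x, u, w) ⟶ (op u, op x, x, u, w)) ≫ j₁ u u w x ≫ β u w =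
          F.map ((𝟙 (op u'), 𝟙 (op x), 𝟙 x, g, 𝟙 w) :
            (op u', op x, x, u, w) ⟶ (op u', op x, x, u', w)) ≫ j₁ u' u' w x ≫ β u' w) →
      ∃! ψ : ∀ w : C₃, H₁.obj w ⟶ K.obj w,
        (∀ {w w' : C₃} (e : w ⟶ w'), H₁.map e ≫ ψ w' = ψ w ≫ K.map e) ∧
        (∀ (u : C₂) (w : C₃), h₁ u w ≫ ψ w = β u w))
    -- the symmetric iterated coend: inner coends over `C₂` with parameters
    (G₂ : C₁ → C₁ → C₃ → A)
    (j₂ : ∀ (x y : C₁) (w : C₃) (u : C₂), F.obj (op u, op x, y, u, w) ⟶ G₂ x y w)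
    (hj₂dinat : ∀ (x y : C₁) (w : C₃) {u u' : C₂} (g : u ⟶ u'),
      F.map ((g.op, 𝟙 (op x), 𝟙 y, 𝟙 u, 𝟙 w) :
          (op u', op x, y, u, w) ⟶ (op u, op x, y, u, w)) ≫ j₂ x y w u =
        F.map ((𝟙 (op u'), 𝟙 (op x), 𝟙 y, g, 𝟙 w) :
          (op u', op x, y, u, w) ⟶ (op u', op x, y, u', w)) ≫ j₂ x y w u')
    (hj₂univ : ∀ (x y : C₁) (w : C₃) (a : A)
        (α : ∀ u : C₂, F.obj (op u, op x, y, u, w) ⟶ a),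
      (∀ {u u' : C₂} (g : u ⟶ u'),
        F.map ((g.op, 𝟙 (op x), 𝟙 y, 𝟙 u, 𝟙 w) :
            (op u', op x, y, u, w) ⟶ (op u, op x, y, u, w)) ≫ α u =
          F.map ((𝟙 (op u'), 𝟙 (op x), 𝟙 y, g, 𝟙 w) :
            (op u', op x, y, u, w) ⟶ (op u', op x, y, u', w)) ≫ α u') →
      ∃! κ : G₂ x y w ⟶ a, ∀ u : C₂, j₂ x y w u ≫ κ = α u)
    -- a left exact coend `H₂` of `G₂` over `C₁`, with family `h₂`
    (H₂ : C₃ ⥤ A) (hH₂lex : PreservesFiniteLimits H₂)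
    (h₂ : ∀ (x : C₁) (w : C₃), G₂ x x w ⟶ H₂.obj w)
    (hh₂nat : ∀ (x : C₁) {w w' : C₃} (e : w ⟶ w') (u : C₂),
      j₂ x x w u ≫ h₂ x w ≫ H₂.map e =
        F.map ((𝟙 (op u), 𝟙 (op x), 𝟙 x, 𝟙 u, e) :
          (op u, op x, x, u, w) ⟶ (op u, op x, x, u, w')) ≫ j₂ x x w' u ≫ h₂ x w')
    (hh₂dinat : ∀ {x x' : C₁} (f : x ⟶ x') (w : C₃) (u : C₂),
      F.map ((𝟙 (op u), f.op, 𝟙 x, 𝟙 u, 𝟙 w) :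
          (op u, op x', x, u, w) ⟶ (op u, op x, x, u, w)) ≫ j₂ x x w u ≫ h₂ x w =
        F.map ((𝟙 (op u), 𝟙 (op x'), f, 𝟙 u, 𝟙 w) :
          (op u, op x', x, u, w) ⟶ (op u, op x', x', u, w)) ≫ j₂ x' x' w u ≫ h₂ x' w)
    (hh₂univ : ∀ (K : C₃ ⥤ A), PreservesFiniteLimits K →
      ∀ (β : ∀ (x : C₁) (w : C₃), G₂ x x w ⟶ K.obj w),
      (∀ (x : C₁) {w w' : C₃} (e : w ⟶ w') (u : C₂),
        j₂ x x w u ≫ β x w ≫ K.map e =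
          F.map ((𝟙 (op u), 𝟙 (op x), 𝟙 x, 𝟙 u, e) :
            (op u, op x, x, u, w) ⟶ (op u, op x, x, u, w')) ≫ j₂ x x w' u ≫ β x w') →
      (∀ {x x' : C₁} (f : x ⟶ x') (w : C₃) (u : C₂),
        F.map ((𝟙 (op u), f.op, 𝟙 x, 𝟙 u, 𝟙 w) :
            (op u, op x', x, u, w) ⟶ (op u, op x, x, u, w)) ≫ j₂ x x w u ≫ β x w =
          F.map ((𝟙 (op u), 𝟙 (op x'), f, 𝟙 u, 𝟙 w) :
            (op u, op x', x, u, w) ⟶ (op u, op x', x', u, w)) ≫ j₂ x' x' w u ≫ β x' w) →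
      ∃! ψ : ∀ w : C₃, H₂.obj w ⟶ K.obj w,
        (∀ {w w' : C₃} (e : w ⟶ w'), H₂.map e ≫ ψ w' = ψ w ≫ K.map e) ∧
        (∀ (x : C₁) (w : C₃), h₂ x w ≫ ψ w = β x w)) :
    -- CONCLUSION: there is a unique natural transformation `φ : H₁ ⟶ H₂` compatible
    -- with the composite dinatural families, and it is an isomorphism
    ∃! φ : ∀ w : C₃, H₁.obj w ⟶ H₂.obj w,
      (∀ {w w' : C₃} (e : w ⟶ w'), H₁.map e ≫ φ w' = φ w ≫ H₂.map e) ∧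
      (∀ (u : C₂) (x : C₁) (w : C₃),
        (j₁ u u w x ≫ h₁ u w) ≫ φ w = j₂ x x w u ≫ h₂ x w) ∧
      (∀ w : C₃, IsIso (φ w)) := by
  refine existsUnique_isIso_of_universal_family
    (fun u x w => F.obj (op u, op x, x, u, w))
    (fun K γ => PreservesFiniteLimits K ∧
      (∀ (u : C₂) (x : C₁) {w w' : C₃} (e : w ⟶ w'),
        γ u x w ≫ K.map e =
          F.map ((𝟙 (op u), 𝟙 (op x), 𝟙 x, 𝟙 u, e) :
            (op u, op x, x, u, w) ⟶ (op u, op x, x, u, w')) ≫ γ u x w') ∧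
      (∀ {u u' : C₂} (g : u ⟶ u') (x : C₁) (w : C₃),
        F.map ((g.op, 𝟙 (op x), 𝟙 x, 𝟙 u, 𝟙 w) :
            (op u', op x, x, u, w) ⟶ (op u, op x, x, u, w)) ≫ γ u x w =
          F.map ((𝟙 (op u'), 𝟙 (op x), 𝟙 x, g, 𝟙 w) :
            (op u', op x, x, u, w) ⟶ (op u', op x, x, u', w)) ≫ γ u' x w) ∧
      (∀ (u : C₂) {x x' : C₁} (f : x ⟶ x') (w : C₃),
        F.map ((𝟙 (op u), f.op, 𝟙 x, 𝟙 u, 𝟙 w) :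
            (op u, op x', x, u, w) ⟶ (op u, op x, x, u, w)) ≫ γ u x w =
          F.map ((𝟙 (op u), 𝟙 (op x'), f, 𝟙 u, 𝟙 w) :
            (op u, op x', x, u, w) ⟶ (op u, op x', x', u, w)) ≫ γ u x' w))
    H₁ H₂ (fun u x w => j₁ u u w x ≫ h₁ u w) (fun u x w => j₂ x x w u ≫ h₂ x w)
    ⟨hH₁lex, fun u x _ _ e => (Category.assoc _ _ _).trans (hh₁nat u e x),
      fun g x w => hh₁dinat g w x, fun u _ _ f w => ?_⟩
    ⟨hH₂lex, fun u x _ _ e => (Category.assoc _ _ _).trans (hh₂nat x e u),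
      fun g x w => ?_, fun u _ _ f w => hh₂dinat f w u⟩ ?_ ?_
  · rw [← Category.assoc, hj₁dinat, Category.assoc]
  · rw [← Category.assoc, hj₂dinat, Category.assoc]
  · rintro K γ ⟨hK, hnat, hdu, hdx⟩
    choose κ hκ hκu using fun u w =>
      hj₁univ u u w (K.obj w) (fun x => γ u x w) (fun f => hdx u f w)
    obtain ⟨ψ, ⟨hψn, hψ⟩, hψu⟩ := hh₁univ K hK κ
      (fun u _ _ e x => by rw [← Category.assoc, hκ, hκ, hnat])
      (fun g w x => by rw [hκ, hκ, hdu])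
    exact ⟨ψ, ⟨hψn, fun u x w => by rw [Category.assoc, hψ, hκ]⟩,
      fun ψ' hψ' => hψu ψ' ⟨hψ'.1, fun u w => hκu u w _ fun x => by
        rw [← Category.assoc]; exact hψ'.2 u x w⟩⟩
  · rintro K γ ⟨hK, hnat, hdu, hdx⟩
    choose κ hκ hκu using fun x w =>
      hj₂univ x x w (K.obj w) (fun u => γ u x w) (fun g => hdu g x w)
    obtain ⟨ψ, ⟨hψn, hψ⟩, hψu⟩ := hh₂univ K hK κ
      (fun x _ _ e u => by rw [← Category.assoc, hκ, hκ, hnat])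
      (fun f w u => by rw [hκ, hκ, hdx])
    exact ⟨ψ, ⟨hψn, fun u x w => by rw [Category.assoc, hψ, hκ]⟩,
      fun ψ' hψ' => hψu ψ' ⟨hψ'.1, fun x w => hκu x w _ fun u => by
        rw [← Category.assoc]; exact hψ'.2 u x w⟩⟩
end
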